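/- arXiv:1808.08679 — 2 statements merged into one kernel-verified Lean document; each statement's English description precedes it below -/
import Mathlib

section
/- For all nonnegative integer vectors μ = (μ_1,…,μ_m) and ν = (ν_1,…,ν_n) with common sum d, the number of m×n matrices with nonnegative integer entries whose i-th row sums to μ_i and whose j-th column sums to ν_j equals the sum, over all partitions λ of d, of |Tab(λ,ν)| · |Tab(λ,μ)|. -/
/-- The weight of a semistandard Young tableau: `ssytWeight T i` is the number of cells of the
tableau whose entry equals `i`. -/
def ssytWeight {μ : YoungDiagram} (T : SemistandardYoungTableau μ) (i : ℕ) : ℕ :=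
  (μ.cells.filter fun c => T c.1 c.2 = i).card

/-- `tabCard μ ν` is the number of semistandard Young tableaux of shape `μ` and weight `ν`,
where `ν : Fin n → ℕ`: the entry `j` (for `j < n`) occurs exactly `ν j` times, and no entry
`≥ n` occurs. -/
noncomputable def tabCard (μ : YoungDiagram) {n : ℕ} (ν : Fin n → ℕ) : ℕ :=
  Set.ncard {T : SemistandardYoungTableau μ |
    ∀ j : ℕ, ssytWeight T j = if h : j < n then ν ⟨j, h⟩ else 0}

/-- The Schur polynomial `s_μ(x_0, …, x_{n-1})`, as the generating function of semistandard
Young tableaux of shape `μ` with entries in `{0, …, n-1}`. -/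
noncomputable def schurPoly (n : ℕ) (μ : YoungDiagram) : MvPolynomial (Fin n) ℤ :=
  ∑ᶠ (T : SemistandardYoungTableau μ) (_ : ∀ c ∈ μ.cells, T c.1 c.2 < n),
    ∏ i : Fin n, (MvPolynomial.X i : MvPolynomial (Fin n) ℤ) ^ ssytWeight T (i : ℕ)

/-- The number of odd rows (odd parts) of a Young diagram. -/
def oddRowsCount (lam : YoungDiagram) : ℕ :=
  lam.rowLens.countP fun r => r % 2 = 1

/-- The number of odd columns of a Young diagram. -/
def oddColsCount (lam : YoungDiagram) : ℕ :=
  oddRowsCount lam.transpose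

/-- A Young diagram is a *threshold* partition if its Frobenius coordinates satisfy
`β i = α i + 1` for each `i` up to the Durfee rank; with 0-indexed diagrams this says that
`colLen i = rowLen i + 1` for each diagonal cell `(i, i)`. -/
def YoungDiagram.IsThreshold (lam : YoungDiagram) : Prop :=
  ∀ i : ℕ, (i, i) ∈ lam → lam.colLen i = lam.rowLen i + 1

namespace YoungDiagram

theorem ext_rowLen {κ lam : YoungDiagram} (h : ∀ i, κ.rowLen i = lam.rowLen i) : κ = lam := by
  ext ⟨i, j⟩
  rw [mem_cells, mem_cells, mem_iff_lt_rowLen, mem_iff_lt_rowLen, h]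

theorem card_eq_sum_rowLen (lam : YoungDiagram) {N : ℕ} (hN : lam.rowLen N = 0) :
    lam.card = ∑ i ∈ Finset.range N, lam.rowLen i := by
  have hmaps : ∀ c ∈ lam.cells, c.1 ∈ Finset.range N := by
    rintro ⟨i, j⟩ hc
    rw [mem_cells, mem_iff_lt_rowLen] at hc
    rw [Finset.mem_range]
    by_contra! hi
    have := lam.rowLen_anti N i hi
    omega
  rw [YoungDiagram.card, Finset.card_eq_sum_card_fiberwise hmaps]
  exact Finset.sum_congr rfl fun i _ => (rowLen_eq_card lam).symm

theorem fst_lt_card {lam : YoungDiagram} {i j : ℕ} (h : (i, j) ∈ lam) : i < lam.card :=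
  (mem_iff_lt_colLen.mp h).trans_le (by
    rw [colLen_eq_card]; exact Finset.card_filter_le _ _)

theorem snd_lt_card {lam : YoungDiagram} {i j : ℕ} (h : (i, j) ∈ lam) : j < lam.card :=
  (mem_iff_lt_rowLen.mp h).trans_le (by
    rw [rowLen_eq_card]; exact Finset.card_filter_le _ _)

theorem rowLen_eq_zero_of_card_le (lam : YoungDiagram) {i : ℕ} (h : lam.card ≤ i) :
    lam.rowLen i = 0 := by
  by_contra hne
  have := fst_lt_card (mem_iff_lt_rowLen.mpr (Nat.pos_of_ne_zero hne))
  omega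

theorem finite_card_eq (d : ℕ) : {lam : YoungDiagram | lam.card = d}.Finite := by
  refine Set.Finite.of_finite_image (f := YoungDiagram.cells)
    ((Finset.finite_toSet (Finset.range d ×ˢ Finset.range d).powerset).subset ?_)
    fun _ _ _ _ h => YoungDiagram.ext h
  rintro _ ⟨lam, rfl, rfl⟩
  rw [Finset.mem_coe, Finset.mem_powerset]
  rintro ⟨i, j⟩ hc
  rw [Finset.mem_product, Finset.mem_range, Finset.mem_range]
  exact ⟨fst_lt_card hc, snd_lt_card hc⟩

theorem card_eq_zero_iff {lam : YoungDiagram} : lam.card = 0 ↔ lam = ⊥ := by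
  rw [YoungDiagram.card, Finset.card_eq_zero, YoungDiagram.ext_iff, cells_bot]

/-- The Young diagram whose first `N` row lengths are given by `f`, when `f` is antitone. -/
def ofRowLenFun (N : ℕ) (f : ℕ → ℕ) : YoungDiagram where
  cells := (Finset.range N ×ˢ Finset.range (f 0)).filter fun c => ∀ i ≤ c.1, c.2 < f i
  isLowerSet := by
    rintro ⟨i, j⟩ ⟨i', j'⟩ ⟨hi, hj⟩ h
    simp only [Finset.coe_filter, Finset.mem_product, Finset.mem_range, Set.mem_ofPred_eq] at *
    exact ⟨⟨by omega, by omega⟩, fun k hk => hj.trans_lt (h.2 k (hk.trans hi))⟩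

theorem rowLen_ofRowLenFun {N : ℕ} {f : ℕ → ℕ} (hf : ∀ i, f (i + 1) ≤ f i)
    (hN : ∀ i, N ≤ i → f i = 0) (i : ℕ) : (ofRowLenFun N f).rowLen i = f i := by
  have hanti : Antitone f := antitone_nat_of_succ_le hf
  have key : ∀ j, j < (ofRowLenFun N f).rowLen i ↔ j < f i := by
    intro j
    rw [← mem_iff_lt_rowLen, ← mem_cells]
    simp only [ofRowLenFun, Finset.mem_filter, Finset.mem_product, Finset.mem_range]
    refine ⟨fun h => h.2 i le_rfl, fun h => ⟨⟨?_, h.trans_le (hanti (Nat.zero_le i))⟩,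
      fun k hk => h.trans_le (hanti hk)⟩⟩
    by_contra! hi
    have := hN i hi
    omega
  exact le_antisymm (not_lt.mp fun h => lt_irrefl _ ((key _).mp h))
    (not_lt.mp fun h => lt_irrefl _ ((key _).mpr h))

/-- `lam / κ` is a horizontal strip with `a` cells. -/
structure IsHorizontalStrip (a : ℕ) (κ lam : YoungDiagram) : Prop where
  rowLen_le : ∀ i, κ.rowLen i ≤ lam.rowLen i
  rowLen_succ_le : ∀ i, lam.rowLen (i + 1) ≤ κ.rowLen i
  card_eq : lam.card = κ.card + a

namespace IsHorizontalStrip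

variable {a : ℕ} {κ lam : YoungDiagram}

theorem le (h : IsHorizontalStrip a κ lam) : κ ≤ lam := by
  rintro ⟨i, j⟩ hc
  exact mem_iff_lt_rowLen.mpr ((mem_iff_lt_rowLen.mp hc).trans_le (h.rowLen_le i))

theorem mem_of_lt (h : IsHorizontalStrip a κ lam) {i i' j : ℕ} (hi : i < i')
    (hc : (i', j) ∈ lam) : (i, j) ∈ κ :=
  mem_iff_lt_rowLen.mpr ((mem_iff_lt_rowLen.mp hc).trans_le
    ((lam.rowLen_anti _ _ hi).trans (h.rowLen_succ_le i)))

theorem of_mem (hle : κ ≤ lam) (hmem : ∀ i j, (i + 1, j) ∈ lam → (i, j) ∈ κ)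
    (hcard : lam.card = κ.card + a) : IsHorizontalStrip a κ lam where
  rowLen_le _ := not_lt.mp fun h =>
    lt_irrefl _ (mem_iff_lt_rowLen.mp (hle (mem_iff_lt_rowLen.mpr h)))
  rowLen_succ_le i := not_lt.mp fun h =>
    lt_irrefl _ (mem_iff_lt_rowLen.mp (hmem i _ (mem_iff_lt_rowLen.mpr h)))
  card_eq := hcard

end IsHorizontalStrip

/-- The diagrams obtained from `κ` by adding a horizontal strip of size `a`. -/
noncomputable def addStrip (a : ℕ) (κ : YoungDiagram) : Finset YoungDiagram :=
  ((finite_card_eq (κ.card + a)).subset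
    (t := {lam | IsHorizontalStrip a κ lam}) fun _ h => h.card_eq).toFinset

/-- The diagrams obtained from `lam` by removing a horizontal strip of size `a`. -/
noncomputable def removeStrip (a : ℕ) (lam : YoungDiagram) : Finset YoungDiagram :=
  ((finite_card_eq (lam.card - a)).subset
    (t := {κ | IsHorizontalStrip a κ lam}) fun κ h => by
      have := IsHorizontalStrip.card_eq h
      change κ.card = lam.card - a
      omega).toFinset

@[simp]
theorem mem_addStrip {a : ℕ} {κ lam : YoungDiagram} :
    lam ∈ addStrip a κ ↔ IsHorizontalStrip a κ lam := by
  simp [addStrip]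

@[simp]
theorem mem_removeStrip {a : ℕ} {κ lam : YoungDiagram} :
    κ ∈ removeStrip a lam ↔ IsHorizontalStrip a κ lam := by
  simp [removeStrip]

/-- The row lengths of the lower corner of the local growth rule with upper corner `γ` and
sides `α` and `β`. -/
def lowerCornerFun (α β γ : YoungDiagram) (i : ℕ) : ℕ :=
  min (α.rowLen i) (β.rowLen i) + max (α.rowLen (i + 1)) (β.rowLen (i + 1)) - γ.rowLen (i + 1)

/-- The row lengths of the upper corner of the local growth rule with lower corner `δ`,
sides `α` and `β`, and multiplicity `j`. -/
def upperCornerFun (α β δ : YoungDiagram) (j : ℕ) : ℕ → ℕ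
  | 0 => max (α.rowLen 0) (β.rowLen 0) + j
  | i + 1 =>
    min (α.rowLen i) (β.rowLen i) + max (α.rowLen (i + 1)) (β.rowLen (i + 1)) - δ.rowLen i

/-- The lower corner of the local growth rule. -/
def lowerCorner (α β γ : YoungDiagram) : YoungDiagram :=
  ofRowLenFun (α.card + β.card) (lowerCornerFun α β γ)

/-- The upper corner of the local growth rule. -/
def upperCorner (α β δ : YoungDiagram) (j : ℕ) : YoungDiagram :=
  ofRowLenFun (α.card + β.card + 1) (upperCornerFun α β δ j)

theorem card_add_card_eq_of_corner {α β γ δ : YoungDiagram} {j : ℕ}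
    (h0 : γ.rowLen 0 = max (α.rowLen 0) (β.rowLen 0) + j)
    (h : ∀ i, γ.rowLen (i + 1) + δ.rowLen i =
      min (α.rowLen i) (β.rowLen i) + max (α.rowLen (i + 1)) (β.rowLen (i + 1))) :
    γ.card + δ.card = j + α.card + β.card := by
  obtain ⟨N, hN⟩ : ∃ N, N = α.card + β.card := ⟨_, rfl⟩
  have hα := α.rowLen_eq_zero_of_card_le (i := N) (by omega)
  have hβ := β.rowLen_eq_zero_of_card_le (i := N) (by omega)
  have hα' := α.rowLen_eq_zero_of_card_le (i := N + 1) (by omega)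
  have hβ' := β.rowLen_eq_zero_of_card_le (i := N + 1) (by omega)
  have hN' := h N
  rw [α.card_eq_sum_rowLen hα', β.card_eq_sum_rowLen hβ',
    γ.card_eq_sum_rowLen (N := N + 1) (by omega), δ.card_eq_sum_rowLen (N := N) (by omega)]
  have main : ∀ M, ∑ i ∈ Finset.range (M + 1), γ.rowLen i + ∑ i ∈ Finset.range M, δ.rowLen i +
      min (α.rowLen M) (β.rowLen M) = j + ∑ i ∈ Finset.range (M + 1), α.rowLen i +
        ∑ i ∈ Finset.range (M + 1), β.rowLen i := by
    intro M
    induction M with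
    | zero => simp; omega
    | succ M ih =>
      have := h M
      rw [Finset.sum_range_succ (fun i => γ.rowLen i) (M + 1),
        Finset.sum_range_succ (fun i => δ.rowLen i) M,
        Finset.sum_range_succ (fun i => α.rowLen i) (M + 1),
        Finset.sum_range_succ (fun i => β.rowLen i) (M + 1)]
      omega
  have := main N
  omega

theorem rowLen_lowerCorner {a b : ℕ} {α β γ : YoungDiagram} (hα : IsHorizontalStrip b α γ)
    (hβ : IsHorizontalStrip a β γ) (i : ℕ) :
    (lowerCorner α β γ).rowLen i = lowerCornerFun α β γ i := by
  refine rowLen_ofRowLenFun (fun i => ?_) (fun i hi => ?_) i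
  · have h1 := hα.rowLen_le (i + 1)
    have h2 := hβ.rowLen_le (i + 1)
    have h3 := hα.rowLen_succ_le (i + 1)
    have h4 := hβ.rowLen_succ_le (i + 1)
    have h5 := hα.rowLen_succ_le i
    have h6 := hβ.rowLen_succ_le i
    have h7 := hα.rowLen_le (i + 1 + 1)
    have h8 := hβ.rowLen_le (i + 1 + 1)
    simp only [lowerCornerFun]
    omega
  · have h1 := α.rowLen_eq_zero_of_card_le (i := i) (by omega)
    have h2 := α.rowLen_eq_zero_of_card_le (i := i + 1) (by omega)
    have h3 := β.rowLen_eq_zero_of_card_le (i := i + 1) (by omega)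
    simp [lowerCornerFun, h1, h2, h3]

theorem rowLen_upperCorner {a b : ℕ} {α β δ : YoungDiagram} (hα : IsHorizontalStrip a δ α)
    (hβ : IsHorizontalStrip b δ β) (j i : ℕ) :
    (upperCorner α β δ j).rowLen i = upperCornerFun α β δ j i := by
  refine rowLen_ofRowLenFun (fun i => ?_) (fun i hi => ?_) i
  · have h1 := hα.rowLen_le i
    have h2 := hβ.rowLen_le i
    have h3 := hα.rowLen_succ_le i
    have h4 := hβ.rowLen_succ_le i
    cases i with
    | zero => simp only [upperCornerFun]; omega
    | succ i =>
      have h5 := hα.rowLen_le i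
      have h6 := hβ.rowLen_le i
      have h7 := hα.rowLen_succ_le i
      have h8 := hβ.rowLen_succ_le i
      simp only [upperCornerFun]
      omega
  · obtain ⟨i, rfl⟩ : ∃ k, i = k + 1 := ⟨i - 1, by omega⟩
    have h1 := α.rowLen_eq_zero_of_card_le (i := i) (by omega)
    have h2 := α.rowLen_eq_zero_of_card_le (i := i + 1) (by omega)
    have h3 := β.rowLen_eq_zero_of_card_le (i := i + 1) (by omega)
    simp [upperCornerFun, h1, h2, h3]

theorem lowerCorner_isHorizontalStrip {a b : ℕ} {α β γ : YoungDiagram}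
    (hα : IsHorizontalStrip b α γ) (hβ : IsHorizontalStrip a β γ) {j : ℕ}
    (hj : γ.rowLen 0 = max (α.rowLen 0) (β.rowLen 0) + j) :
    j ≤ a ∧ j ≤ b ∧ IsHorizontalStrip (b - j) (lowerCorner α β γ) β ∧
      IsHorizontalStrip (a - j) (lowerCorner α β γ) α := by
  have hrow := rowLen_lowerCorner hα hβ
  have hb : ∀ i, (lowerCorner α β γ).rowLen i ≤ α.rowLen i ∧
      (lowerCorner α β γ).rowLen i ≤ β.rowLen i ∧
      α.rowLen (i + 1) ≤ (lowerCorner α β γ).rowLen i ∧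
      β.rowLen (i + 1) ≤ (lowerCorner α β γ).rowLen i ∧
      γ.rowLen (i + 1) + (lowerCorner α β γ).rowLen i =
        min (α.rowLen i) (β.rowLen i) + max (α.rowLen (i + 1)) (β.rowLen (i + 1)) := by
    intro i
    rw [hrow]
    have h1 := hα.rowLen_le (i + 1)
    have h2 := hβ.rowLen_le (i + 1)
    have h5 := hα.rowLen_succ_le i
    have h6 := hβ.rowLen_succ_le i
    simp only [lowerCornerFun]
    omega
  have hcard := card_add_card_eq_of_corner hj fun i => (hb i).2.2.2.2
  have hle : ∀ {η : YoungDiagram}, (∀ i, (lowerCorner α β γ).rowLen i ≤ η.rowLen i) →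
      (lowerCorner α β γ).card ≤ η.card := fun {η} h => Finset.card_le_card <| by
    rintro ⟨i, j⟩ hc
    rw [mem_cells, mem_iff_lt_rowLen] at hc ⊢
    exact hc.trans_le (h i)
  have hA := hle fun i => (hb i).1
  have hB := hle fun i => (hb i).2.1
  have h1 := hα.card_eq
  have h2 := hβ.card_eq
  exact ⟨by omega, by omega,
    ⟨fun i => (hb i).2.1, fun i => (hb i).2.2.2.1, by omega⟩,
    ⟨fun i => (hb i).1, fun i => (hb i).2.2.1, by omega⟩⟩

theorem upperCorner_isHorizontalStrip {a b j : ℕ} {α β δ : YoungDiagram} (hja : j ≤ a)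
    (hjb : j ≤ b) (hα : IsHorizontalStrip (a - j) δ α) (hβ : IsHorizontalStrip (b - j) δ β) :
    IsHorizontalStrip a β (upperCorner α β δ j) ∧
      IsHorizontalStrip b α (upperCorner α β δ j) := by
  have hrow := rowLen_upperCorner hα hβ j
  have hb : ∀ i, α.rowLen i ≤ (upperCorner α β δ j).rowLen i ∧
      β.rowLen i ≤ (upperCorner α β δ j).rowLen i ∧
      (upperCorner α β δ j).rowLen (i + 1) ≤ α.rowLen i ∧
      (upperCorner α β δ j).rowLen (i + 1) ≤ β.rowLen i ∧
      (upperCorner α β δ j).rowLen (i + 1) + δ.rowLen i =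
        min (α.rowLen i) (β.rowLen i) + max (α.rowLen (i + 1)) (β.rowLen (i + 1)) := by
    intro i
    rw [hrow, hrow]
    have h1 := hα.rowLen_le i
    have h2 := hβ.rowLen_le i
    have h3 := hα.rowLen_succ_le i
    have h4 := hβ.rowLen_succ_le i
    cases i with
    | zero => simp only [upperCornerFun]; omega
    | succ i =>
      have h5 := hα.rowLen_le i
      have h6 := hβ.rowLen_le i
      simp only [upperCornerFun]
      omega
  have hcard := card_add_card_eq_of_corner (γ := upperCorner α β δ j) (j := j) (hrow 0)
    fun i => (hb i).2.2.2.2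
  have h1 := hα.card_eq
  have h2 := hβ.card_eq
  exact ⟨⟨fun i => (hb i).2.1, fun i => (hb i).2.2.2.1, by omega⟩,
    ⟨fun i => (hb i).1, fun i => (hb i).2.2.1, by omega⟩⟩

/-- The commutation relation between adding and removing horizontal strips. -/
theorem sum_addStrip_removeStrip (a b : ℕ) (β : YoungDiagram) (f : YoungDiagram → ℕ) :
    ∑ γ ∈ addStrip a β, ∑ α ∈ removeStrip b γ, f α =
      ∑ j ∈ Finset.range (min a b + 1), ∑ δ ∈ removeStrip (b - j) β,
        ∑ α ∈ addStrip (a - j) δ, f α := by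
  simp only [Finset.sum_sigma']
  refine Finset.sum_bij'
    (fun x _ => ⟨x.1.rowLen 0 - max (x.2.rowLen 0) (β.rowLen 0), lowerCorner x.2 β x.1, x.2⟩)
    (fun y _ => ⟨upperCorner y.2.2 β y.2.1 y.1, y.2.2⟩) ?_ ?_ ?_ ?_ ?_
  · rintro ⟨γ, α⟩ hx
    simp only [Finset.mem_sigma, mem_addStrip, mem_removeStrip, Finset.mem_range] at hx ⊢
    obtain ⟨hβ, hα⟩ := hx
    have h1 := hα.rowLen_le 0
    have h2 := hβ.rowLen_le 0
    obtain ⟨hja, hjb, h3, h4⟩ := lowerCorner_isHorizontalStrip hα hβ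
      (j := γ.rowLen 0 - max (α.rowLen 0) (β.rowLen 0)) (by omega)
    exact ⟨by omega, h3, h4⟩
  · rintro ⟨j, δ, α⟩ hy
    simp only [Finset.mem_sigma, mem_addStrip, mem_removeStrip, Finset.mem_range] at hy ⊢
    obtain ⟨hj, hβ, hα⟩ := hy
    exact upperCorner_isHorizontalStrip (by omega) (by omega) hα hβ
  · rintro ⟨γ, α⟩ hx
    simp only [Finset.mem_sigma, mem_addStrip, mem_removeStrip] at hx
    obtain ⟨hβ, hα⟩ := hx
    have h1 := hα.rowLen_le 0
    have h2 := hβ.rowLen_le 0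
    obtain ⟨hja, hjb, h3, h4⟩ := lowerCorner_isHorizontalStrip hα hβ
      (j := γ.rowLen 0 - max (α.rowLen 0) (β.rowLen 0)) (by omega)
    simp only [Sigma.mk.injEq, heq_eq_eq, and_true]
    refine ext_rowLen fun i => ?_
    rw [rowLen_upperCorner h4 h3]
    cases i with
    | zero => simp only [upperCornerFun]; omega
    | succ i =>
      have h5 := hα.rowLen_le (i + 1)
      have h6 := hβ.rowLen_le (i + 1)
      have h7 := hα.rowLen_succ_le i
      have h8 := hβ.rowLen_succ_le i
      simp only [upperCornerFun, rowLen_lowerCorner hα hβ, lowerCornerFun]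
      omega
  · rintro ⟨j, δ, α⟩ hy
    simp only [Finset.mem_sigma, mem_addStrip, mem_removeStrip, Finset.mem_range] at hy
    obtain ⟨hj, hβ, hα⟩ := hy
    obtain ⟨h1, h2⟩ := upperCorner_isHorizontalStrip (by omega) (by omega) hα hβ
    have hrow := rowLen_upperCorner hα hβ j
    have hj' : (upperCorner α β δ j).rowLen 0 - max (α.rowLen 0) (β.rowLen 0) = j := by
      rw [hrow, upperCornerFun]; omega
    have hδ : lowerCorner α β (upperCorner α β δ j) = δ := by
      refine ext_rowLen fun i => ?_
      have h3 := hα.rowLen_le i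
      have h4 := hβ.rowLen_le i
      rw [rowLen_lowerCorner h2 h1, lowerCornerFun, hrow, upperCornerFun]
      omega
    simp only [hj', hδ]
  · intros
    rfl

end YoungDiagram

theorem Set.Finite.ncard_eq_sum_ncard_fiber {α β : Type*} [DecidableEq β] {s : Set α}
    (hs : s.Finite) {t : Finset β} {f : α → β} (hf : ∀ x ∈ s, f x ∈ t) :
    s.ncard = ∑ b ∈ t, {x ∈ s | f x = b}.ncard := by
  rw [Set.ncard_eq_toFinset_card s hs,
    Finset.card_eq_sum_card_fiberwise (f := f) (t := t) (fun x hx => hf x (by simpa using hx))]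
  refine Finset.sum_congr rfl fun b _ => ?_
  rw [← Set.ncard_coe_finset]
  congr 1
  ext x
  simp

namespace SemistandardYoungTableau

open YoungDiagram

variable {κ lam : YoungDiagram}

theorem apply_ne_of_ssytWeight_eq_zero {T : SemistandardYoungTableau lam} {k i j : ℕ}
    (h : ssytWeight T k = 0) (hc : (i, j) ∈ lam) : T i j ≠ k := by
  rw [ssytWeight, Finset.card_eq_zero, Finset.filter_eq_empty_iff] at h
  exact h (x := (i, j)) hc

/-- The cells of a tableau with entries less than `n`. -/
def below (T : SemistandardYoungTableau lam) (n : ℕ) : YoungDiagram where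
  cells := lam.cells.filter fun c => T c.1 c.2 < n
  isLowerSet := by
    rintro ⟨i, j⟩ ⟨i', j'⟩ ⟨hi, hj⟩ h
    simp only [Finset.coe_filter, Set.mem_ofPred_eq, mem_cells] at *
    have h1 : (i', j) ∈ lam := lam.up_left_mem hi le_rfl h.1
    exact ⟨lam.up_left_mem hi hj h.1,
      ((T.row_weak_of_le hj h1).trans (T.col_weak hi h.1)).trans_lt h.2⟩

theorem mem_below {T : SemistandardYoungTableau lam} {n i j : ℕ} :
    (i, j) ∈ T.below n ↔ (i, j) ∈ lam ∧ T i j < n := by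
  rw [← mem_cells]
  simp [below]

/-- The restriction of a tableau to a smaller shape. -/
def restrict (T : SemistandardYoungTableau lam) (h : κ ≤ lam) : SemistandardYoungTableau κ where
  entry i j := if (i, j) ∈ κ then T i j else 0
  row_weak' hj hc := by
    rw [if_pos hc, if_pos (κ.up_left_mem le_rfl hj.le hc)]
    exact T.row_weak hj (h hc)
  col_strict' hi hc := by
    rw [if_pos hc, if_pos (κ.up_left_mem hi.le le_rfl hc)]
    exact T.col_strict hi (h hc)
  zeros' hc := if_neg hc

theorem restrict_apply (T : SemistandardYoungTableau lam) (h : κ ≤ lam) (i j : ℕ) :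
    T.restrict h i j = if (i, j) ∈ κ then T i j else 0 := rfl

/-- The extension of a tableau by a horizontal strip filled with a new largest entry. -/
def extend (T : SemistandardYoungTableau κ) {a n : ℕ} (h : IsHorizontalStrip a κ lam)
    (hT : ∀ i j, (i, j) ∈ κ → T i j < n) : SemistandardYoungTableau lam where
  entry i j := if (i, j) ∈ κ then T i j else if (i, j) ∈ lam then n else 0
  row_weak' {i j1 j2} hj hc := by
    by_cases h2 : (i, j2) ∈ κ
    · rw [if_pos h2, if_pos (κ.up_left_mem le_rfl hj.le h2)]
      exact T.row_weak hj h2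
    · rw [if_neg h2, if_pos hc]
      split_ifs with h3
      · exact (hT _ _ h3).le
      · exact le_rfl
      · exact Nat.zero_le n
  col_strict' {i1 i2 j} hi hc := by
    have h1 := h.mem_of_lt hi hc
    rw [if_pos h1]
    by_cases h2 : (i2, j) ∈ κ
    · rw [if_pos h2]
      exact T.col_strict hi h2
    · rw [if_neg h2, if_pos hc]
      exact hT _ _ h1
  zeros' hc := by rw [if_neg fun h1 => hc (h.le h1), if_neg hc]

theorem extend_apply (T : SemistandardYoungTableau κ) {a n : ℕ} (h : IsHorizontalStrip a κ lam)
    (hT : ∀ i j, (i, j) ∈ κ → T i j < n) (i j : ℕ) :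
    T.extend h hT i j = if (i, j) ∈ κ then T i j else if (i, j) ∈ lam then n else 0 := rfl

/-- The tableaux of shape `lam` and weight `ν`. -/
def ofWeight (lam : YoungDiagram) {n : ℕ} (ν : Fin n → ℕ) : Set (SemistandardYoungTableau lam) :=
  {T | ∀ j : ℕ, ssytWeight T j = if h : j < n then ν ⟨j, h⟩ else 0}

theorem apply_lt_of_mem_ofWeight {n : ℕ} {ν : Fin n → ℕ} {T : SemistandardYoungTableau lam}
    (hT : T ∈ ofWeight lam ν) {i j : ℕ} (hc : (i, j) ∈ lam) : T i j < n := by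
  by_contra h
  exact apply_ne_of_ssytWeight_eq_zero ((hT (T i j)).trans (dif_neg h)) hc rfl

theorem finite_ofWeight (lam : YoungDiagram) {n : ℕ} (ν : Fin n → ℕ) :
    (ofWeight lam ν).Finite := by
  have hinj : Function.Injective fun (T : ofWeight lam ν) (c : lam.cells) =>
      (⟨T.1 c.1.1 c.1.2, apply_lt_of_mem_ofWeight T.2 c.2⟩ : Fin n) := by
    rintro ⟨T, hT⟩ ⟨T', hT'⟩ h
    ext i j
    by_cases hc : (i, j) ∈ lam
    · simpa using congrFun h ⟨(i, j), hc⟩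
    · exact (T.zeros hc).trans (T'.zeros hc).symm
  exact Set.finite_coe_iff.mp (Finite.of_injective _ hinj)

theorem below_isHorizontalStrip {n : ℕ} {ν : Fin (n + 1) → ℕ} {T : SemistandardYoungTableau lam}
    (hT : T ∈ ofWeight lam ν) : IsHorizontalStrip (ν (Fin.last n)) (T.below n) lam := by
  refine .of_mem (fun c hc => (mem_below.mp hc).1) (fun i j hc => mem_below.mpr ⟨?_, ?_⟩) ?_
  · exact lam.up_left_mem (Nat.le_succ i) le_rfl hc
  · exact (T.col_strict (Nat.lt_succ_self i) hc).trans_le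
      (Nat.le_of_lt_succ (apply_lt_of_mem_ofWeight hT hc))
  · have h := hT n
    rw [dif_pos (Nat.lt_succ_self n), ssytWeight] at h
    change _ = ν (Fin.last n) at h
    rw [← h, YoungDiagram.card, YoungDiagram.card, below,
      ← Finset.card_filter_add_card_filter_not (s := lam.cells) (fun c => T c.1 c.2 < n)]
    congr 2
    refine Finset.filter_congr fun c hc => ?_
    have := apply_lt_of_mem_ofWeight hT (i := c.1) (j := c.2) hc
    omega

theorem restrict_mem_ofWeight {n : ℕ} {ν : Fin (n + 1) → ℕ} {T : SemistandardYoungTableau lam}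
    (hT : T ∈ ofWeight lam ν) (h : T.below n = κ) (hle : κ ≤ lam) :
    T.restrict hle ∈ ofWeight κ (Fin.init ν) := by
  subst h
  intro k
  split_ifs with hk
  · have hk' := hT k
    rw [dif_pos (by omega)] at hk'
    change _ = ν ⟨k, _⟩
    rw [← hk', ssytWeight, ssytWeight]
    congr 1
    ext ⟨i, j⟩
    simp only [Finset.mem_filter, mem_cells, restrict_apply, mem_below]
    grind
  · rw [ssytWeight, Finset.card_eq_zero, Finset.filter_eq_empty_iff]
    rintro ⟨i, j⟩ hc
    rw [mem_cells] at hc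
    have h := (mem_below.mp hc).2
    rw [restrict_apply, if_pos hc]
    dsimp only
    omega

theorem below_extend (T : SemistandardYoungTableau κ) {a n : ℕ} (h : IsHorizontalStrip a κ lam)
    (hT : ∀ i j, (i, j) ∈ κ → T i j < n) : (T.extend h hT).below n = κ := by
  ext ⟨i, j⟩
  rw [mem_cells, mem_cells, mem_below, extend_apply]
  have h1 := hT i j
  have h2 : (i, j) ∈ κ → (i, j) ∈ lam := fun hc => h.le hc
  grind

theorem extend_mem_ofWeight {n : ℕ} {ν : Fin (n + 1) → ℕ} {T : SemistandardYoungTableau κ}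
    (hT : T ∈ ofWeight κ (Fin.init ν)) (h : IsHorizontalStrip (ν (Fin.last n)) κ lam) :
    T.extend h (fun _ _ hc => apply_lt_of_mem_ofWeight hT hc) ∈ ofWeight lam ν := by
  intro k
  have hlt : ∀ i j, (i, j) ∈ κ → T i j < n := fun _ _ hc => apply_lt_of_mem_ofWeight hT hc
  rcases lt_trichotomy k n with hk | rfl | hk
  · have hk' := hT k
    rw [dif_pos hk] at hk'
    change _ = ν ⟨k, _⟩ at hk'
    rw [dif_pos (by omega), ← hk', ssytWeight, ssytWeight]
    congr 1
    ext ⟨i, j⟩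
    have h2 : (i, j) ∈ κ → (i, j) ∈ lam := fun hc => h.le hc
    rw [Finset.mem_filter, Finset.mem_filter]
    simp only [mem_cells, extend_apply]
    grind
  · rw [dif_pos (Nat.lt_succ_self k)]
    change _ = ν (Fin.last k)
    have h1 : lam.cells.filter (fun c => T.extend h hlt c.1 c.2 = k) = lam.cells \ κ.cells := by
      ext ⟨i, j⟩
      have h2 := hlt i j
      rw [Finset.mem_filter, Finset.mem_sdiff]
      simp only [mem_cells, extend_apply]
      grind
    have h2 := h.card_eq
    rw [ssytWeight, h1, Finset.card_sdiff_of_subset (cells_subset_iff.mpr h.le)]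
    simp only [YoungDiagram.card] at h2
    omega
  · rw [dif_neg (by omega), ssytWeight, Finset.card_eq_zero, Finset.filter_eq_empty_iff]
    rintro ⟨i, j⟩ hc
    rw [mem_cells] at hc
    have h2 := hlt i j
    simp only [extend_apply]
    grind

end SemistandardYoungTableau

section Kostka

open YoungDiagram SemistandardYoungTableau

theorem tabCard_eq_ncard_ofWeight (lam : YoungDiagram) {n : ℕ} (ν : Fin n → ℕ) :
    tabCard lam ν = (ofWeight lam ν).ncard := rfl

theorem tabCard_succ (lam : YoungDiagram) {n : ℕ} (ν : Fin (n + 1) → ℕ) :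
    tabCard lam ν = ∑ κ ∈ removeStrip (ν (Fin.last n)) lam, tabCard κ (Fin.init ν) := by
  classical
  rw [tabCard_eq_ncard_ofWeight, (finite_ofWeight lam ν).ncard_eq_sum_ncard_fiber
    (f := fun T => T.below n) fun T hT => mem_removeStrip.mpr (below_isHorizontalStrip hT)]
  refine Finset.sum_congr rfl fun κ hκ => ?_
  rw [mem_removeStrip] at hκ
  rw [tabCard_eq_ncard_ofWeight]
  refine Set.ncard_congr (fun T _ => T.restrict hκ.le)
    (fun T hT => restrict_mem_ofWeight hT.1 hT.2 _) ?_ ?_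
  · rintro T T' ⟨hT, hTκ⟩ ⟨hT', hTκ'⟩ heq
    ext i j
    have h1 := DFunLike.congr_fun heq i
    have h2 := congrFun h1 j
    rw [restrict_apply, restrict_apply] at h2
    by_cases hc : (i, j) ∈ κ
    · rwa [if_pos hc, if_pos hc] at h2
    · by_cases hl : (i, j) ∈ lam
      · have h3 := apply_lt_of_mem_ofWeight hT hl
        have h4 := apply_lt_of_mem_ofWeight hT' hl
        have h5 : ¬ T i j < n := fun h => hc (hTκ ▸ mem_below.mpr ⟨hl, h⟩)
        have h6 : ¬ T' i j < n := fun h => hc (hTκ' ▸ mem_below.mpr ⟨hl, h⟩)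
        omega
      · rw [T.zeros hl, T'.zeros hl]
  · intro T hT
    refine ⟨T.extend hκ fun _ _ hc => apply_lt_of_mem_ofWeight hT hc,
      ⟨extend_mem_ofWeight hT hκ, below_extend _ _ _⟩, ?_⟩
    ext i j
    rw [restrict_apply, extend_apply]
    split_ifs with hc
    · rfl
    · exact (T.zeros hc).symm

theorem tabCard_fin_zero (lam : YoungDiagram) (ν : Fin 0 → ℕ) [Decidable (lam = ⊥)] :
    tabCard lam ν = if lam = ⊥ then 1 else 0 := by
  rw [tabCard_eq_ncard_ofWeight]
  split_ifs with h
  · subst h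
    have : ofWeight ⊥ ν = {default} := by
      ext T
      simp only [Set.mem_singleton_iff]
      refine ⟨fun _ => ?_, fun _ j => by simp [ssytWeight]⟩
      ext i j
      rw [T.zeros (notMem_bot _), SemistandardYoungTableau.zeros _ (notMem_bot _)]
    rw [this, Set.ncard_singleton]
  · rw [Set.ncard_eq_zero (finite_ofWeight lam ν), Set.eq_empty_iff_forall_notMem]
    intro T hT
    refine h (YoungDiagram.ext (Finset.eq_empty_of_forall_notMem fun c hc => ?_))
    exact absurd (apply_lt_of_mem_ofWeight hT (i := c.1) (j := c.2) hc) (Nat.not_lt_zero _)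

theorem tabCard_bot {n : ℕ} : tabCard ⊥ (0 : Fin n → ℕ) = 1 := by
  rw [tabCard_eq_ncard_ofWeight, Set.ncard_eq_one]
  refine ⟨default, Set.eq_singleton_iff_unique_mem.mpr ⟨fun j => by simp [ssytWeight], ?_⟩⟩
  intro T _
  ext i j
  rw [T.zeros (notMem_bot _), SemistandardYoungTableau.zeros _ (notMem_bot _)]

/-- The vectors bounded by `ν` with sum `a`. -/
def subvectors {n : ℕ} (a : ℕ) (ν : Fin n → ℕ) : Finset (Fin n → ℕ) :=
  (Finset.Iic ν).filter fun k => ∑ i, k i = a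

theorem mem_subvectors {n a : ℕ} {ν k : Fin n → ℕ} :
    k ∈ subvectors a ν ↔ (∀ i, k i ≤ ν i) ∧ ∑ i, k i = a := by
  simp [subvectors, Pi.le_def]

theorem sum_subvectors_succ {n : ℕ} (a : ℕ) (ν : Fin (n + 1) → ℕ) (g : (Fin (n + 1) → ℕ) → ℕ) :
    ∑ k ∈ subvectors a ν, g k = ∑ j ∈ Finset.range (min a (ν (Fin.last n)) + 1),
      ∑ k ∈ subvectors (a - j) (Fin.init ν), g (Fin.snoc k j) := by
  rw [Finset.sum_sigma']
  refine Finset.sum_bij' (fun k _ => ⟨k (Fin.last n), Fin.init k⟩)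
    (fun x _ => Fin.snoc x.2 x.1) ?_ ?_ ?_ ?_ ?_
  · intro k hk
    rw [mem_subvectors, Fin.sum_univ_castSucc] at hk
    simp only [Finset.mem_sigma, Finset.mem_range, mem_subvectors, Fin.init]
    have := hk.1 (Fin.last n)
    exact ⟨by omega, fun i => hk.1 _, by omega⟩
  · rintro ⟨j, k⟩ hx
    simp only [Finset.mem_sigma, Finset.mem_range, mem_subvectors] at hx
    rw [mem_subvectors, Fin.forall_fin_succ', Fin.sum_univ_castSucc]
    simp only [Fin.snoc_castSucc, Fin.snoc_last]
    exact ⟨⟨hx.2.1, by omega⟩, by omega⟩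
  · intro k _
    simp
  · rintro ⟨j, k⟩ _
    simp
  · intro k _
    simp

theorem sum_addStrip_tabCard (a : ℕ) (κ : YoungDiagram) {n : ℕ} (ν : Fin n → ℕ) :
    ∑ lam ∈ addStrip a κ, tabCard lam ν = ∑ k ∈ subvectors a ν, tabCard κ (ν - k) := by
  classical
  induction n generalizing a κ with
  | zero =>
    simp only [tabCard_fin_zero, Finset.sum_ite_eq', Finset.sum_const, smul_eq_mul, mem_addStrip]
    have hiff : IsHorizontalStrip a κ ⊥ ↔ a = 0 ∧ κ = ⊥ := by
      constructor
      · intro h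
        have := h.card_eq
        rw [card_eq_zero_iff.mpr rfl] at this
        exact ⟨by omega, card_eq_zero_iff.mp (by omega)⟩
      · rintro ⟨rfl, rfl⟩
        exact .of_mem le_rfl (fun _ _ h => absurd h (notMem_bot _)) rfl
    have hcard : (subvectors a ν).card = if a = 0 then 1 else 0 := by
      split_ifs with h
      · rw [Finset.card_eq_one]
        refine ⟨0, Finset.eq_singleton_iff_unique_mem.mpr
          ⟨mem_subvectors.mpr ⟨fun i => i.elim0, by simp [h]⟩, fun _ _ => Subsingleton.elim _ _⟩⟩
      · rw [Finset.card_eq_zero, Finset.eq_empty_iff_forall_notMem]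
        intro k hk
        exact h (by simpa using (mem_subvectors.mp hk).2.symm)
    rw [hcard]
    simp only [hiff]
    split_ifs <;> simp_all
  | succ n ih =>
    simp only [tabCard_succ _ ν]
    rw [sum_addStrip_removeStrip, sum_subvectors_succ]
    refine Finset.sum_congr rfl fun j _ => ?_
    simp only [ih]
    rw [Finset.sum_comm]
    refine Finset.sum_congr rfl fun k _ => ?_
    rw [tabCard_succ]
    have h1 : (ν - Fin.snoc (α := fun _ => ℕ) k j) (Fin.last n) = ν (Fin.last n) - j := by simp
    have h2 : Fin.init (ν - Fin.snoc (α := fun _ => ℕ) k j) = Fin.init ν - k := by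
      ext i
      simp [Fin.init]
    rw [h1, h2]

/-- The matrices of natural numbers with row sums `μ` and column sums `ν`. -/
def transportMatrices {m n : ℕ} (μ : Fin m → ℕ) (ν : Fin n → ℕ) : Set (Fin m → Fin n → ℕ) :=
  {A | (∀ i, ∑ j, A i j = μ i) ∧ ∀ j, ∑ i, A i j = ν j}

theorem finite_transportMatrices {m n : ℕ} (μ : Fin m → ℕ) (ν : Fin n → ℕ) :
    (transportMatrices μ ν).Finite := by
  refine (Set.finite_Iic (fun _ => ν : Fin m → Fin n → ℕ)).subset fun A hA i j => ?_
  refine le_of_le_of_eq ?_ (hA.2 j)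
  exact Finset.single_le_sum (f := fun i => A i j) (fun _ _ => Nat.zero_le _) (Finset.mem_univ i)

theorem ncard_transportMatrices_succ {m n : ℕ} (μ : Fin (m + 1) → ℕ) (ν : Fin n → ℕ) :
    (transportMatrices μ ν).ncard = ∑ k ∈ subvectors (μ (Fin.last m)) ν,
      (transportMatrices (Fin.init μ) (ν - k)).ncard := by
  classical
  rw [(finite_transportMatrices μ ν).ncard_eq_sum_ncard_fiber (f := fun A => A (Fin.last m))
    (t := subvectors (μ (Fin.last m)) ν)]
  · refine Finset.sum_congr rfl fun k hk => ?_
    rw [mem_subvectors] at hk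
    refine Set.ncard_congr (fun A _ => Fin.init (α := fun _ => Fin n → ℕ) A) ?_ ?_ ?_
    · rintro A ⟨⟨hr, hc⟩, rfl⟩
      refine ⟨fun i => hr i.castSucc, fun j => ?_⟩
      have := hc j
      rw [Fin.sum_univ_castSucc] at this
      simp only [Fin.init, Pi.sub_apply]
      omega
    · rintro A B ⟨_, hA⟩ ⟨_, hB⟩ h
      have := Fin.snoc_init_self (α := fun _ => Fin n → ℕ) A
      have := Fin.snoc_init_self (α := fun _ => Fin n → ℕ) B
      simp_all
    · rintro A ⟨hr, hc⟩
      refine ⟨Fin.snoc (α := fun _ => Fin n → ℕ) A k, ⟨⟨?_, fun j => ?_⟩, ?_⟩, ?_⟩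
      · rw [Fin.forall_fin_succ']
        simp only [Fin.snoc_castSucc, Fin.snoc_last]
        exact ⟨hr, hk.2⟩
      · rw [Fin.sum_univ_castSucc]
        simp only [Fin.snoc_castSucc, Fin.snoc_last]
        have h1 := hc j
        have h2 := hk.1 j
        simp only [Pi.sub_apply] at h1
        omega
      · simp
      · simp
  · rintro A ⟨hr, hc⟩
    refine mem_subvectors.mpr ⟨fun j => ?_, hr _⟩
    rw [← hc j]
    exact Finset.single_le_sum (f := fun i => A i j) (fun _ _ => Nat.zero_le _)
      (Finset.mem_univ (Fin.last m))

theorem ncard_transportMatrices_eq_sum (m n d : ℕ) (μ : Fin m → ℕ) (ν : Fin n → ℕ)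
    (hμ : ∑ i, μ i = d) (hν : ∑ j, ν j = d) :
    (transportMatrices μ ν).ncard =
      ∑ lam ∈ (finite_card_eq d).toFinset, tabCard lam ν * tabCard lam μ := by
  classical
  induction m generalizing d ν with
  | zero =>
    obtain rfl : d = 0 := by simpa using hμ.symm
    obtain rfl : ν = 0 := by
      ext j
      exact (Finset.sum_eq_zero_iff.mp hν) j (Finset.mem_univ j)
    have h1 : transportMatrices μ (0 : Fin n → ℕ) = {0} := by
      ext A
      simp [transportMatrices, eq_iff_true_of_subsingleton]
    have h2 : (finite_card_eq 0).toFinset = {⊥} := by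
      ext lam
      rw [Set.Finite.mem_toFinset, Finset.mem_singleton]
      exact card_eq_zero_iff
    rw [h1, h2, Set.ncard_singleton, Finset.sum_singleton, tabCard_fin_zero, tabCard_bot]
    simp
  | succ m ih =>
    have hμ' : ∑ i, Fin.init μ i + μ (Fin.last m) = d := by
      rw [← hμ, Fin.sum_univ_castSucc]
      rfl
    have hsum : ∀ k ∈ subvectors (μ (Fin.last m)) ν,
        ∑ j, (ν - k) j = ∑ i, Fin.init μ i := by
      intro k hk
      rw [mem_subvectors] at hk
      have : ∑ j, (ν - k) j + ∑ j, k j = ∑ j, ν j := by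
        rw [← Finset.sum_add_distrib]
        exact Finset.sum_congr rfl fun j _ => Nat.sub_add_cancel (hk.1 j)
      omega
    rw [ncard_transportMatrices_succ, Finset.sum_congr rfl fun k hk =>
      ih _ (Fin.init μ) (ν - k) rfl (hsum k hk), Finset.sum_comm]
    simp only [tabCard_succ _ μ, Finset.mul_sum, ← Finset.sum_mul]
    simp only [← sum_addStrip_tabCard, Finset.sum_mul]
    refine Finset.sum_comm' fun κ lam => ?_
    simp only [Set.Finite.mem_toFinset, Set.mem_ofPred_eq, mem_addStrip, mem_removeStrip]
    refine ⟨fun ⟨h1, h2⟩ => ⟨h2, ?_⟩, fun ⟨h1, h2⟩ => ⟨?_, h1⟩⟩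
    · have := h2.card_eq
      omega
    · have := h1.card_eq
      omega

end Kostka

/-- **RSK correspondence, enumerative form.** The number of `m × n` matrices of nonnegative
integers with row sums `μ` and column sums `ν` (both summing to `d`) equals
`∑_{λ ⊢ d} |Tab(λ,ν)| · |Tab(λ,μ)|`. -/
theorem rsk_card (m n d : ℕ) (μ : Fin m → ℕ) (ν : Fin n → ℕ)
    (hμ : ∑ i, μ i = d) (hν : ∑ j, ν j = d) :
    Set.ncard {A : Matrix (Fin m) (Fin n) ℕ |
        (∀ i, ∑ j, A i j = μ i) ∧ (∀ j, ∑ i, A i j = ν j)} =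
      ∑ᶠ (lam : YoungDiagram) (_ : lam.card = d), tabCard lam ν * tabCard lam μ := by
  refine (ncard_transportMatrices_eq_sum m n d μ ν hμ hν).trans ?_
  exact (finsum_mem_eq_finite_toFinset_sum _ (YoungDiagram.finite_card_eq d)).symm
end

section
/- For every nonnegative integer vector ν = (ν_1,…,ν_n) with sum d and every nonnegative integer k, the number of symmetric n×n matrices with nonnegative integer entries, row sums ν_1,…,ν_n, and trace equal to k equals the number of semistandard Young tableaux of weight ν whose shape λ (a partition of d) has exactly k odd columns, i.e. the conjugate partition λ' has exactly k odd parts. -/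
namespace GrowthDiagram

open Finset

/-- `Interlaces f g` says that the partition `g` (given by its row lengths) is obtained from `f`
by adding a horizontal strip. -/
def Interlaces (f g : ℕ → ℕ) : Prop :=
  ∀ x, f x ≤ g x ∧ g (x + 1) ≤ f x

/-- The forward local rule of a growth diagram for the Robinson–Schensted–Knuth correspondence. -/
def localUp (f g h : ℕ → ℕ) (m : ℕ) : ℕ → ℕ
  | 0 => max (f 0) (g 0) + m
  | x + 1 => max (f (x + 1)) (g (x + 1)) + min (f x) (g x) - h x

/-- The backward local rule of a growth diagram. -/
def localDown (f g r : ℕ → ℕ) : ℕ → ℕ :=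
  fun x => max (f (x + 1)) (g (x + 1)) + min (f x) (g x) - r (x + 1)

theorem localUp_succ (f g h : ℕ → ℕ) (m x : ℕ) : localUp f g h m (x + 1) =
    max (f (x + 1)) (g (x + 1)) + min (f x) (g x) - h x := rfl

theorem localUp_comm (f g h : ℕ → ℕ) (m : ℕ) : localUp f g h m = localUp g f h m := by
  funext x
  cases x <;> simp [localUp, max_comm, min_comm]

theorem localDown_comm (f g r : ℕ → ℕ) : localDown f g r = localDown g f r := by
  funext x
  simp [localDown, max_comm, min_comm]

theorem Interlaces.localUp_left {f g h : ℕ → ℕ} (hf : Interlaces h f) (hg : Interlaces h g)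
    (m : ℕ) : Interlaces f (localUp f g h m) := by
  intro x
  have h1 := hf x
  have h2 := hg x
  cases x with
  | zero => simp only [localUp]; omega
  | succ x =>
    have h3 := hf x
    have h4 := hg x
    simp only [localUp]; omega

theorem Interlaces.localDown_left {f g r : ℕ → ℕ} (hf : Interlaces f r) (hg : Interlaces g r) :
    Interlaces (localDown f g r) f := by
  intro x
  have h1 := hf x
  have h2 := hg x
  have h3 := hf (x + 1)
  have h4 := hg (x + 1)
  simp only [localDown]; omega

theorem localDown_localUp {f g h : ℕ → ℕ} (hf : Interlaces h f) (hg : Interlaces h g) (m : ℕ) :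
    localDown f g (localUp f g h m) = h := by
  funext x
  have h1 := hf x
  have h2 := hg x
  simp only [localDown, localUp]; omega

theorem localUp_localDown {f g r : ℕ → ℕ} (hf : Interlaces f r) (hg : Interlaces g r) :
    localUp f g (localDown f g r) (r 0 - max (f 0) (g 0)) = r := by
  funext x
  cases x with
  | zero =>
    have h1 := hf 0
    have h2 := hg 0
    simp only [localUp]; omega
  | succ x =>
    have h1 := hf x
    have h2 := hg x
    have h3 := hf (x + 1)
    have h4 := hg (x + 1)
    simp only [localDown, localUp]; omega

theorem sum_localUp {f g h : ℕ → ℕ} (hf : Interlaces h f) (hg : Interlaces h g) (m N : ℕ) :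
    ∑ x ∈ range (N + 1), localUp f g h m x + ∑ x ∈ range N, h x =
      ∑ x ∈ range N, f x + ∑ x ∈ range N, g x + max (f N) (g N) + m := by
  induction N with
  | zero => simp [localUp]
  | succ N ih =>
    have h1 := hf N
    have h2 := hg N
    rw [sum_range_succ _ (N + 1), sum_range_succ h, sum_range_succ f, sum_range_succ g,
      localUp_succ]
    omega

theorem alternatingSum_localUp_self {f h : ℕ → ℕ} (hf : Interlaces h f) (m N : ℕ) :
    ∑ x ∈ range (N + 1), (-1 : ℤ) ^ x * localUp f f h m x =
      m + ∑ x ∈ range N, (-1 : ℤ) ^ x * h x + (-1) ^ N * f N := by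
  induction N with
  | zero => simp [localUp]; ring
  | succ N ih =>
    have h1 := hf N
    rw [sum_range_succ, ih, sum_range_succ _ N, localUp_succ, max_self, min_self,
      Nat.cast_sub (by omega)]
    push_cast
    ring

/-- The growth diagram of a matrix `A`, started from empty partitions on the two axes. -/
def growth (A : ℕ → ℕ → ℕ) : ℕ → ℕ → ℕ → ℕ
  | 0, _ => 0
  | _ + 1, 0 => 0
  | i + 1, j + 1 =>
    localUp (growth A i (j + 1)) (growth A (i + 1) j) (growth A i j) (A i j)

/-- The backward growth diagram started from the same sequence `c` on both axes. -/
def shrink (c : ℕ → ℕ → ℕ) : ℕ → ℕ → ℕ → ℕ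
  | 0, q => c q
  | p + 1, 0 => c (p + 1)
  | p + 1, q + 1 => localDown (shrink c p (q + 1)) (shrink c (p + 1) q) (shrink c p q)

section growth

variable (A : ℕ → ℕ → ℕ)

@[simp] theorem growth_zero_left (j : ℕ) : growth A 0 j = 0 := by rw [growth]

@[simp] theorem growth_zero_right (i : ℕ) : growth A i 0 = 0 := by cases i <;> rw [growth]

theorem growth_succ (i j : ℕ) : growth A (i + 1) (j + 1) =
    localUp (growth A i (j + 1)) (growth A (i + 1) j) (growth A i j) (A i j) := by
  rw [growth]

theorem interlaces_growth (i : ℕ) : ∀ j, Interlaces (growth A i j) (growth A i (j + 1)) ∧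
    Interlaces (growth A i j) (growth A (i + 1) j) := by
  have vert : ∀ i, (∀ j, Interlaces (growth A i j) (growth A i (j + 1))) →
      ∀ j, Interlaces (growth A i j) (growth A (i + 1) j) := by
    intro i hi j
    induction j with
    | zero => intro x; simp
    | succ j ih => rw [growth_succ]; exact (hi j).localUp_left ih _
  have horiz : ∀ i j, Interlaces (growth A i j) (growth A i (j + 1)) := by
    intro i
    induction i with
    | zero => intro j x; simp
    | succ i ih =>
      intro j
      rw [growth_succ, localUp_comm]
      exact (vert i ih j).localUp_left (ih j) _
  exact fun j => ⟨horiz i j, vert i (horiz i) j⟩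

theorem growth_symm {A : ℕ → ℕ → ℕ} (hA : ∀ i j, A i j = A j i) (i : ℕ) :
    ∀ j, growth A i j = growth A j i := by
  induction i with
  | zero => simp
  | succ i ihi =>
    intro j
    induction j with
    | zero => simp
    | succ j ihj => rw [growth_succ, growth_succ, localUp_comm, ihi j, ihi (j + 1), ihj, hA]

theorem growth_eq_zero {i x : ℕ} (j : ℕ) (h : i ≤ x) : growth A i j x = 0 := by
  induction i generalizing x with
  | zero => simp
  | succ i ih =>
    obtain ⟨x, rfl⟩ : ∃ y, x = y + 1 := ⟨x - 1, by omega⟩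
    have := ((interlaces_growth A i j).2 x).2
    have := ih (x := x) (by omega)
    cases j with
    | zero => simp
    | succ j => omega

theorem sum_growth {i n : ℕ} (j : ℕ) (h : i ≤ n) :
    ∑ x ∈ range n, growth A i (j + 1) x =
      ∑ x ∈ range n, growth A i j x + ∑ l ∈ range i, A l j := by
  induction i with
  | zero => simp
  | succ i ih =>
    have key := sum_localUp (interlaces_growth A i j).1 (interlaces_growth A i j).2 (A i j) n
    rw [← growth_succ, sum_range_succ, growth_eq_zero A _ h, growth_eq_zero A _ h,
      growth_eq_zero A (i := i) _ (by omega), ih (by omega)] at key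
    rw [sum_range_succ _ i]
    simp only [max_self, add_zero] at key
    omega

theorem alternatingSum_growth {A : ℕ → ℕ → ℕ} (hA : ∀ i j, A i j = A j i) {i n : ℕ} (h : i ≤ n) :
    ∑ x ∈ range n, (-1 : ℤ) ^ x * growth A i i x = ∑ l ∈ range i, (A l l : ℤ) := by
  induction i with
  | zero => simp
  | succ i ih =>
    have key := alternatingSum_localUp_self (interlaces_growth A i i).1 (A i i) n
    have hsucc := growth_succ A i i
    rw [growth_symm hA (i + 1) i] at hsucc
    rw [← hsucc, sum_range_succ, growth_eq_zero A _ h, growth_eq_zero A (i := i) _ (by omega),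
      ih (by omega)] at key
    rw [sum_range_succ _ i]
    simp only [Nat.cast_zero, mul_zero, add_zero] at key
    omega

theorem localDown_growth (i j : ℕ) :
    localDown (growth A i (j + 1)) (growth A (i + 1) j) (growth A (i + 1) (j + 1)) =
      growth A i j := by
  rw [growth_succ]
  exact localDown_localUp (interlaces_growth A i j).1 (interlaces_growth A i j).2 _

theorem growth_eq_shrink {A : ℕ → ℕ → ℕ} (hA : ∀ i j, A i j = A j i) {n : ℕ} (p : ℕ) :
    ∀ q, p ≤ n → q ≤ n →
      growth A (n - p) (n - q) = shrink (fun q => growth A n (n - q)) p q := by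
  induction p with
  | zero => intro q _ _; rw [shrink, Nat.sub_zero]
  | succ p ihp =>
    intro q hp hq
    induction q with
    | zero => rw [shrink, growth_symm hA, Nat.sub_zero]
    | succ q ihq =>
      rw [shrink, ← ihq (by omega), ← ihp q (by omega) (by omega),
        ← ihp (q + 1) (by omega) (by omega), ← localDown_growth A (n - (p + 1)) (n - (q + 1))]
      rw [show n - (p + 1) + 1 = n - p by omega, show n - (q + 1) + 1 = n - q by omega,
        localDown_comm]

/-- The matrix can be read off from its growth diagram. -/
theorem entry_eq (i j : ℕ) : A i j =
    growth A (i + 1) (j + 1) 0 - max (growth A i (j + 1) 0) (growth A (i + 1) j 0) := by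
  rw [growth_succ]
  simp only [localUp]; omega

end growth

section shrink

variable {c : ℕ → ℕ → ℕ}

theorem shrink_zero_right (p : ℕ) : shrink c p 0 = c p := by cases p <;> rw [shrink]

theorem shrink_succ (p q : ℕ) : shrink c (p + 1) (q + 1) =
    localDown (shrink c p (q + 1)) (shrink c (p + 1) q) (shrink c p q) := by
  rw [shrink]

theorem shrink_symm (p : ℕ) : ∀ q, shrink c p q = shrink c q p := by
  induction p with
  | zero => intro q; rw [shrink_zero_right, shrink]
  | succ p ihp =>
    intro q
    induction q with
    | zero => rw [shrink_zero_right, shrink]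
    | succ q ihq => rw [shrink, shrink, localDown_comm, ihp q, ihp (q + 1), ihq]

theorem interlaces_shrink {n : ℕ} (hc : ∀ q < n, Interlaces (c (q + 1)) (c q)) (p : ℕ) :
    ∀ q, p ≤ n → q < n → Interlaces (shrink c p (q + 1)) (shrink c p q) := by
  induction p with
  | zero => intro q _ hq; rw [shrink, shrink]; exact hc q hq
  | succ p ihp =>
    intro q hp hq
    have vert : ∀ q, q ≤ n → Interlaces (shrink c (p + 1) q) (shrink c p q) := by
      intro q hq
      induction q with
      | zero => rw [shrink_zero_right, shrink_zero_right]; exact hc p hp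
      | succ q ihq =>
        rw [shrink]
        exact (ihp q (by omega) (by omega)).localDown_left (ihq (by omega))
    rw [shrink, localDown_comm]
    exact (vert q hq.le).localDown_left (ihp q (by omega) hq)

theorem shrink_eq_zero {n : ℕ} (hc : ∀ q < n, Interlaces (c (q + 1)) (c q)) (hn : c n = 0)
    {q : ℕ} (hq : q ≤ n) : shrink c n q = 0 := by
  induction q with
  | zero => rw [shrink_zero_right, hn]
  | succ q ih =>
    funext x
    have := (interlaces_shrink hc n q le_rfl hq x).1
    rw [ih (by omega)] at this
    simpa using this

/-- Every chain of interlacing partitions is the last row of the growth diagram of a symmetric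
matrix. -/
theorem exists_growth_eq {n : ℕ} (hc : ∀ j < n, Interlaces (c j) (c (j + 1))) (h0 : c 0 = 0) :
    ∃ A : ℕ → ℕ → ℕ, (∀ i j, A i j = A j i) ∧ (∀ i j, ¬ (i < n ∧ j < n) → A i j = 0) ∧
      ∀ j ≤ n, growth A n j = c j := by
  set c' : ℕ → ℕ → ℕ := fun q => c (n - q) with hc'
  have hint : ∀ q < n, Interlaces (c' (q + 1)) (c' q) := by
    intro q hq
    have := hc (n - (q + 1)) (by omega)
    rwa [show n - (q + 1) + 1 = n - q by omega] at this
  have hzero : c' n = 0 := by simp [hc', h0]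
  set S : ℕ → ℕ → ℕ → ℕ := fun i j => shrink c' (n - i) (n - j) with hS
  have S_symm : ∀ i j, S i j = S j i := fun i j => shrink_symm _ _
  set A : ℕ → ℕ → ℕ := fun i j => if i < n ∧ j < n then
    S (i + 1) (j + 1) 0 - max (S i (j + 1) 0) (S (i + 1) j 0) else 0 with hA
  have S_horiz : ∀ i j, j < n → Interlaces (S i j) (S i (j + 1)) := by
    intro i j hj
    have := interlaces_shrink hint (n - i) (n - (j + 1)) (by omega) (by omega)
    rwa [show n - (j + 1) + 1 = n - j by omega] at this
  have S_eq : ∀ i ≤ n, ∀ j ≤ n, growth A i j = S i j := by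
    intro i
    induction i with
    | zero =>
      intro _ j hj
      rw [growth_zero_left]
      exact (shrink_eq_zero hint hzero (by omega)).symm
    | succ i ihi =>
      intro hi j
      induction j with
      | zero =>
        intro _
        rw [growth_zero_right, S_symm]
        exact (shrink_eq_zero hint hzero (by omega)).symm
      | succ j ihj =>
        intro hj
        have hdown : S i j = localDown (S i (j + 1)) (S (i + 1) j) (S (i + 1) (j + 1)) := by
          have := shrink_succ (c := c') (n - (i + 1)) (n - (j + 1))
          rw [show n - (i + 1) + 1 = n - i by omega, show n - (j + 1) + 1 = n - j by omega] at this
          simp only [hS]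
          rw [this, localDown_comm]
        rw [growth_succ, ihi (by omega) _ hj, ihi (by omega) _ (by omega), ihj (by omega), hdown]
        have hAij : A i j = S (i + 1) (j + 1) 0 - max (S i (j + 1) 0) (S (i + 1) j 0) :=
          if_pos ⟨hi, hj⟩
        rw [hAij]
        refine localUp_localDown ?_ (S_horiz _ _ hj)
        rw [S_symm i, S_symm (i + 1)]
        exact S_horiz _ _ hi
  refine ⟨A, fun i j => ?_, fun i j h => if_neg h, fun j hj => ?_⟩
  · simp only [hA]
    rw [S_symm (i + 1) (j + 1), S_symm i, S_symm (i + 1) j, max_comm]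
    simp only [and_comm]
  · rw [S_eq n le_rfl j hj]
    simp only [hS, hc', Nat.sub_self]
    rw [shrink, show n - (n - j) = j by omega]

end shrink

/-- Chains of interlacing partitions starting at the empty one, with size increments `ν`, whose
last term has alternating sum `k`; they are constant from position `n` on. -/
def chains (n k : ℕ) (ν : Fin n → ℕ) : Set (ℕ → ℕ → ℕ) :=
  {c | c 0 = 0 ∧ (∀ j < n, Interlaces (c j) (c (j + 1))) ∧ (∀ j, n ≤ j → c j = c n) ∧
    (∀ j : Fin n, ∑ x ∈ range n, c (j + 1) x = ∑ x ∈ range n, c j x + ν j) ∧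
    ∑ x ∈ range n, (-1 : ℤ) ^ x * c n x = k}

/-- Extension of a square matrix by zero. -/
def extendZero {n : ℕ} (A : Matrix (Fin n) (Fin n) ℕ) (i j : ℕ) : ℕ :=
  if h : i < n ∧ j < n then A ⟨i, h.1⟩ ⟨j, h.2⟩ else 0

theorem extendZero_coe {n : ℕ} (A : Matrix (Fin n) (Fin n) ℕ) (i j : Fin n) :
    extendZero A i j = A i j := by
  simp [extendZero]

theorem extendZero_symm {n : ℕ} {A : Matrix (Fin n) (Fin n) ℕ} (hA : A.IsSymm) (i j : ℕ) :
    extendZero A i j = extendZero A j i := by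
  by_cases h : i < n ∧ j < n
  · rw [extendZero, extendZero, dif_pos h, dif_pos h.symm, hA.apply]
  · rw [extendZero, extendZero, dif_neg h, dif_neg (mt And.symm h)]

theorem bijOn_growth (n k : ℕ) (ν : Fin n → ℕ) :
    Set.BijOn (fun (A : Matrix (Fin n) (Fin n) ℕ) j => growth (extendZero A) n (min j n))
      {A | A.IsSymm ∧ (∀ i, ∑ j, A i j = ν i) ∧ ∑ i, A i i = k} (chains n k ν) := by
  refine ⟨?_, ?_, ?_⟩
  · rintro A ⟨hA, hrow, htr⟩
    refine ⟨by simp, fun j hj => ?_, fun j hj => by simp [hj], fun j => ?_, ?_⟩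
    · simp only
      rw [min_eq_left hj.le, min_eq_left (Nat.succ_le_of_lt hj)]
      exact (interlaces_growth _ n j).1
    · simp only
      rw [min_eq_left (show (j : ℕ) + 1 ≤ n from j.2), min_eq_left j.2.le, sum_growth _ _ le_rfl,
        ← hrow, sum_range (fun l => extendZero A l j)]
      simp only [extendZero_coe, hA.apply _ j]
    · simp only
      rw [min_self, alternatingSum_growth (extendZero_symm hA) le_rfl, sum_range, ← htr]
      simp [extendZero_coe]
  · rintro A ⟨hA, -⟩ B ⟨hB, -⟩ h
    have hbd : ∀ j ≤ n, growth (extendZero A) n j = growth (extendZero B) n j := by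
      intro j hj
      simpa [hj] using congrFun h j
    have hall : ∀ i ≤ n, ∀ j ≤ n, growth (extendZero A) i j = growth (extendZero B) i j := by
      intro i hi j hj
      have h1 := growth_eq_shrink (extendZero_symm hA) (n - i) (n - j) (n.sub_le i) (n.sub_le j)
      have h2 := growth_eq_shrink (extendZero_symm hB) (n - i) (n - j) (n.sub_le i) (n.sub_le j)
      simp only [hbd _ (n.sub_le _)] at h1
      rw [← h2] at h1
      rwa [Nat.sub_sub_self hi, Nat.sub_sub_self hj] at h1
    ext i j
    rw [← extendZero_coe A, ← extendZero_coe B, entry_eq (extendZero A), entry_eq (extendZero B),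
      hall _ i.2 _ j.2, hall _ i.2.le _ j.2, hall _ i.2 _ j.2.le]
  · rintro c ⟨h0, hint, hcst, hwt, halt⟩
    obtain ⟨A, hsymm, hzero, hgr⟩ := exists_growth_eq hint h0
    have hext : extendZero (Matrix.of fun i j : Fin n => A i j) = A := by
      funext i j
      by_cases h : i < n ∧ j < n
      · simp [extendZero, h]
      · rw [extendZero, dif_neg h, hzero i j h]
    refine ⟨Matrix.of fun i j : Fin n => A i j, ⟨?_, fun i => ?_, ?_⟩, ?_⟩
    · ext i j
      exact hsymm _ _
    · have h1 := hwt i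
      rw [← hgr _ i.2, ← hgr _ i.2.le, sum_growth _ _ le_rfl, sum_range (fun l => A l i)] at h1
      simp only [Matrix.of_apply, hsymm i]
      omega
    · rw [← hgr n le_rfl, alternatingSum_growth hsymm le_rfl, sum_range] at halt
      simp only [Matrix.of_apply]
      exact_mod_cast halt
    · funext j
      simp only [hext]
      rw [hgr _ (min_le_right _ _)]
      rcases le_total j n with h | h
      · rw [min_eq_left h]
      · rw [min_eq_right h, hcst j h]

theorem lt_card_iff {s : Finset ℕ} (hs : IsLowerSet (s : Set ℕ)) (x : ℕ) : x < #s ↔ x ∈ s := by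
  refine ⟨fun h => ?_, fun h => ?_⟩
  · by_contra hx
    have : s ⊆ range x := fun y hy => by
      rw [mem_range]
      by_contra! hxy
      exact hx (hs hxy hy)
    have := card_le_card this
    rw [card_range] at this
    omega
  · have : range (x + 1) ⊆ s := fun y hy => hs (by rw [mem_range] at hy; omega) h
    have := card_le_card this
    rw [card_range] at this
    omega

theorem sum_range_ite_lt {M : Type*} [AddCommMonoid M] {a b : ℕ} (h : a ≤ b) (f : ℕ → M) :
    ∑ x ∈ range b, (if x < a then f x else 0) = ∑ x ∈ range a, f x := by
  rw [← sum_filter]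
  congr 1
  ext x
  simp only [mem_filter, mem_range]
  omega

section shape

variable (μ : YoungDiagram) {n : ℕ}

theorem card_filter_cells (p : ℕ → ℕ → Prop) [∀ i x, Decidable (p i x)]
    (hn : ∀ i, n ≤ i → μ.rowLen i = 0) :
    #{c ∈ μ.cells | p c.1 c.2} = ∑ i ∈ range n, #{x ∈ range (μ.rowLen i) | p i x} := by
  rw [← card_sigma]
  refine card_bij' (fun c _ => ⟨c.1, c.2⟩) (fun c _ => (c.1, c.2)) ?_ ?_ ?_ ?_
  · rintro ⟨i, x⟩ h
    simp only [mem_filter, YoungDiagram.mem_cells, YoungDiagram.mem_iff_lt_rowLen] at h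
    simp only [mem_sigma, mem_filter, mem_range]
    refine ⟨?_, h⟩
    by_contra! hi
    have := hn i hi
    omega
  · rintro ⟨i, x⟩ h
    simp only [mem_sigma, mem_filter, mem_range] at h
    simp only [mem_filter, YoungDiagram.mem_cells, YoungDiagram.mem_iff_lt_rowLen]
    exact h.2
  · intros; rfl
  · intros; rfl

theorem card_eq_sum_rowLen (hn : ∀ i, n ≤ i → μ.rowLen i = 0) :
    μ.card = ∑ i ∈ range n, μ.rowLen i := by
  simpa using card_filter_cells μ (fun _ _ => True) hn

theorem alternatingSum_range (m : ℕ) :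
    ∑ x ∈ range m, (-1 : ℤ) ^ x = if m % 2 = 1 then 1 else 0 := by
  induction m with
  | zero => simp
  | succ m ih =>
    rw [sum_range_succ, ih, neg_one_pow_eq_ite]
    simp only [Nat.even_iff]
    split_ifs <;> first | rfl | omega

theorem oddColsCount_eq : oddColsCount μ = #{j ∈ range (μ.rowLen 0) | μ.colLen j % 2 = 1} := by
  rw [oddColsCount, oddRowsCount, YoungDiagram.rowLens, List.countP_map,
    YoungDiagram.colLen_transpose, List.countP_eq_length_filter]
  rw [show μ.transpose.rowLen = μ.colLen from funext μ.rowLen_transpose]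
  rfl

/-- The number of odd columns is the alternating sum of the row lengths. -/
theorem oddColsCount_eq_alternatingSum (hn : ∀ i, n ≤ i → μ.rowLen i = 0) :
    (oddColsCount μ : ℤ) = ∑ x ∈ range n, (-1 : ℤ) ^ x * μ.rowLen x := by
  have hcol : ∀ j, μ.colLen j ≤ n := by
    intro j
    by_contra! h
    rw [← YoungDiagram.mem_iff_lt_colLen, YoungDiagram.mem_iff_lt_rowLen, hn n le_rfl] at h
    omega
  calc (oddColsCount μ : ℤ)
      = ∑ j ∈ range (μ.rowLen 0), ∑ x ∈ range (μ.colLen j), (-1 : ℤ) ^ x := by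
        rw [oddColsCount_eq, card_filter]
        push_cast
        exact sum_congr rfl fun j _ => (alternatingSum_range _).symm
    _ = ∑ j ∈ range (μ.rowLen 0), ∑ x ∈ range n,
          if j < μ.rowLen x then (-1 : ℤ) ^ x else 0 := by
        refine sum_congr rfl fun j _ => ?_
        rw [← sum_range_ite_lt (hcol j)]
        simp only [← YoungDiagram.mem_iff_lt_colLen, YoungDiagram.mem_iff_lt_rowLen]
    _ = ∑ x ∈ range n, (-1 : ℤ) ^ x * μ.rowLen x := by
        rw [sum_comm]
        refine sum_congr rfl fun x _ => ?_
        rw [sum_range_ite_lt (μ.rowLen_anti 0 x x.zero_le)]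
        simp [mul_comm]

end shape

section tableau

variable {μ : YoungDiagram} (T : SemistandardYoungTableau μ)

/-- `tableauChain T j` is the shape formed by the entries of `T` smaller than `j`. -/
def tableauChain (j i : ℕ) : ℕ :=
  #{x ∈ range (μ.rowLen i) | T i x < j}

theorem lt_tableauChain_iff (j i x : ℕ) :
    x < tableauChain T j i ↔ x < μ.rowLen i ∧ T i x < j := by
  rw [tableauChain, lt_card_iff, mem_filter, mem_range]
  intro y z hzy hy
  simp only [coe_filter, mem_range, Set.mem_ofPred_eq] at hy ⊢
  exact ⟨by omega, (T.row_weak_of_le hzy (YoungDiagram.mem_iff_lt_rowLen.2 hy.1)).trans_lt hy.2⟩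

theorem interlaces_tableauChain (j : ℕ) :
    Interlaces (tableauChain T j) (tableauChain T (j + 1)) := by
  intro i
  constructor
  · by_contra! h
    rw [lt_tableauChain_iff] at h
    have := mt (lt_tableauChain_iff T (j + 1) i _).2 (lt_irrefl _)
    omega
  · by_contra! h
    rw [lt_tableauChain_iff] at h
    have h1 := mt (lt_tableauChain_iff T j i _).2 (lt_irrefl _)
    have h2 := T.col_strict i.lt_succ_self (YoungDiagram.mem_iff_lt_rowLen.2 h.1)
    have h3 := μ.rowLen_anti i (i + 1) i.le_succ
    simp only [Nat.succ_eq_add_one] at h2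
    omega

theorem tableauChain_eq_zero {j i : ℕ} (h : j ≤ i) : tableauChain T j i = 0 := by
  induction j generalizing i with
  | zero => simp [tableauChain]
  | succ j ih =>
    obtain ⟨i, rfl⟩ : ∃ y, i = y + 1 := ⟨i - 1, by omega⟩
    have := (interlaces_tableauChain T j i).2
    have := ih (i := i) (by omega)
    omega

theorem tableauChain_succ (j i : ℕ) : tableauChain T (j + 1) i =
    tableauChain T j i + #{x ∈ range (μ.rowLen i) | T i x = j} := by
  rw [tableauChain, tableauChain, ← card_union_of_disjoint, ← filter_or]
  · simp only [Nat.lt_succ_iff_lt_or_eq]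
  · exact disjoint_filter.2 fun x _ h1 h2 => h1.ne h2

section bounded

variable {T} {n : ℕ}

theorem tableauChain_eq_rowLen (hT : ∀ c ∈ μ, T c.1 c.2 < n) {j : ℕ} (hj : n ≤ j) (i : ℕ) :
    tableauChain T j i = μ.rowLen i := by
  rw [tableauChain, filter_true_of_mem, card_range]
  intro x hx
  rw [mem_range] at hx
  exact (hT (i, x) (YoungDiagram.mem_iff_lt_rowLen.2 hx)).trans_le hj

theorem rowLen_eq_zero (hT : ∀ c ∈ μ, T c.1 c.2 < n) {i : ℕ} (hi : n ≤ i) : μ.rowLen i = 0 := by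
  rw [← tableauChain_eq_rowLen hT le_rfl, tableauChain_eq_zero T hi]

theorem sum_tableauChain_succ (hT : ∀ c ∈ μ, T c.1 c.2 < n) (j : ℕ) :
    ∑ i ∈ range n, tableauChain T (j + 1) i =
      ∑ i ∈ range n, tableauChain T j i + ssytWeight T j := by
  rw [ssytWeight, card_filter_cells μ (fun i x => T i x = j) fun i => rowLen_eq_zero hT,
    ← sum_add_distrib]
  exact sum_congr rfl fun i _ => tableauChain_succ T j i

end bounded

theorem entry_lt_of_weight {n : ℕ} (h : ∀ j, n ≤ j → ssytWeight T j = 0) :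
    ∀ c ∈ μ, T c.1 c.2 < n := by
  intro c hc
  by_contra! hn
  have := h _ hn
  rw [ssytWeight, card_eq_zero, filter_eq_empty_iff] at this
  exact this ((YoungDiagram.mem_cells c).2 hc) rfl

theorem weight_eq_zero {n : ℕ} (hT : ∀ c ∈ μ, T c.1 c.2 < n) {j : ℕ} (hj : n ≤ j) :
    ssytWeight T j = 0 := by
  rw [ssytWeight, card_eq_zero, filter_eq_empty_iff]
  intro c hc h
  have := hT c ((YoungDiagram.mem_cells c).1 hc)
  omega

end tableau

theorem sigma_tableau_ext {n : ℕ} {S T : Σ μ : YoungDiagram, SemistandardYoungTableau μ}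
    (hS : ∀ c ∈ S.1, S.2 c.1 c.2 < n) (hT : ∀ c ∈ T.1, T.2 c.1 c.2 < n)
    (h : tableauChain S.2 = tableauChain T.2) : S = T := by
  obtain ⟨μ, S⟩ := S
  obtain ⟨ρ, T⟩ := T
  simp only at hS hT h
  obtain rfl : μ = ρ := by
    ext ⟨i, x⟩
    rw [YoungDiagram.mem_cells, YoungDiagram.mem_cells, YoungDiagram.mem_iff_lt_rowLen,
      YoungDiagram.mem_iff_lt_rowLen, ← tableauChain_eq_rowLen hS le_rfl,
      ← tableauChain_eq_rowLen hT le_rfl, h]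
  congr 1
  ext i x
  by_cases hx : (i, x) ∈ μ
  · have hlt : ∀ j, S i x < j ↔ T i x < j := by
      intro j
      have h1 := lt_tableauChain_iff S j i x
      have h2 := lt_tableauChain_iff T j i x
      rw [YoungDiagram.mem_iff_lt_rowLen] at hx
      rw [h] at h1
      tauto
    exact le_antisymm (Nat.le_of_lt_succ ((hlt _).2 (Nat.lt_succ_self _)))
      (Nat.le_of_lt_succ ((hlt _).1 (Nat.lt_succ_self _)))
  · rw [S.zeros hx, T.zeros hx]

section ofChain

variable {n : ℕ} {c : ℕ → ℕ → ℕ}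

theorem chain_eq_zero (hc : ∀ j < n, Interlaces (c j) (c (j + 1))) (h0 : c 0 = 0) {j i : ℕ}
    (hj : j ≤ n) (hi : j ≤ i) : c j i = 0 := by
  induction j generalizing i with
  | zero => simp [h0]
  | succ j ih =>
    obtain ⟨i, rfl⟩ : ∃ y, i = y + 1 := ⟨i - 1, by omega⟩
    have := (hc j hj i).2
    have := ih (i := i) (by omega) (by omega)
    omega

theorem chain_antitone (hc : ∀ j < n, Interlaces (c j) (c (j + 1))) (h0 : c 0 = 0) {j : ℕ}
    (hj : j ≤ n) : Antitone (c j) := by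
  refine antitone_nat_of_succ_le fun i => ?_
  cases j with
  | zero => simp [h0]
  | succ j => exact ((hc j hj i).2).trans (hc j hj i).1

theorem chain_mono (hc : ∀ j < n, Interlaces (c j) (c (j + 1))) (i : ℕ) {j l : ℕ}
    (hjl : j ≤ l) (hl : l ≤ n) : c j i ≤ c l i := by
  induction l, hjl using Nat.le_induction with
  | base => exact le_rfl
  | succ l _ ih => exact (ih (by omega)).trans (hc l (by omega) i).1

/-- The Young diagram of the last term of a chain. -/
def chainShape (hc : ∀ j < n, Interlaces (c j) (c (j + 1))) (h0 : c 0 = 0) : YoungDiagram where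
  cells := {p ∈ range n ×ˢ range (c n 0) | p.2 < c n p.1}
  isLowerSet := by
    rintro ⟨i, x⟩ ⟨k, y⟩ hle hp
    simp only [Prod.mk_le_mk] at hle
    simp only [coe_filter, mem_product, mem_range, Set.mem_ofPred_eq] at hp ⊢
    have := chain_antitone hc h0 le_rfl hle.1
    omega

theorem mem_chainShape (hc : ∀ j < n, Interlaces (c j) (c (j + 1))) (h0 : c 0 = 0) (i x : ℕ) :
    (i, x) ∈ chainShape hc h0 ↔ x < c n i := by
  rw [← YoungDiagram.mem_cells]
  simp only [chainShape, mem_filter, mem_product, mem_range]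
  have h1 := chain_antitone hc h0 le_rfl i.zero_le
  have h2 := chain_eq_zero hc h0 le_rfl (i := i)
  omega

theorem rowLen_chainShape (hc : ∀ j < n, Interlaces (c j) (c (j + 1))) (h0 : c 0 = 0) (i : ℕ) :
    (chainShape hc h0).rowLen i = c n i := by
  refine eq_of_forall_lt_iff fun x => ?_
  rw [← YoungDiagram.mem_iff_lt_rowLen, mem_chainShape]

theorem card_filter_lt_iff (hc : ∀ j < n, Interlaces (c j) (c (j + 1))) (h0 : c 0 = 0)
    {i x j : ℕ} (hj : j ≤ n) :
    #{y ∈ range n | c (y + 1) i ≤ x} < j ↔ x < c j i := by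
  cases j with
  | zero => simp [h0]
  | succ j =>
    rw [← not_iff_not, not_lt, Nat.succ_le_iff, lt_card_iff, mem_filter, mem_range, not_lt]
    · exact and_iff_right hj
    · intro y z hzy hy
      simp only [coe_filter, mem_range, Set.mem_ofPred_eq] at hy ⊢
      have := chain_mono hc i (show z + 1 ≤ y + 1 by omega) (by omega)
      omega

/-- The tableau of a chain of interlacing partitions. -/
def chainTableau (hc : ∀ j < n, Interlaces (c j) (c (j + 1))) (h0 : c 0 = 0) :
    SemistandardYoungTableau (chainShape hc h0) where
  entry i x := if x < c n i then #{y ∈ range n | c (y + 1) i ≤ x} else 0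
  row_weak' := by
    intro i x y hxy hy
    rw [mem_chainShape] at hy
    rw [if_pos hy, if_pos (hxy.trans hy)]
    exact card_le_card (monotone_filter_right _ fun z _ hz => hz.trans hxy.le)
  col_strict' := by
    intro i k x hik hk
    rw [mem_chainShape] at hk
    have hi : x < c n i := hk.trans_le (chain_antitone hc h0 le_rfl hik.le)
    rw [if_pos hk, if_pos hi]
    set e := #{y ∈ range n | c (y + 1) k ≤ x} with he
    have hen : e < n := (card_filter_lt_iff hc h0 le_rfl).2 hk
    rw [card_filter_lt_iff hc h0 hen.le]
    have h1 : x < c (e + 1) k := (card_filter_lt_iff hc h0 hen).1 e.lt_succ_self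
    obtain ⟨k, rfl⟩ : ∃ y, k = y + 1 := ⟨k - 1, by omega⟩
    have h2 := (hc e hen k).2
    have h3 := chain_antitone hc h0 hen.le (show i ≤ k by omega)
    omega
  zeros' := fun h => if_neg (mt (mem_chainShape hc h0 _ _).2 h)

theorem chainTableau_apply (hc : ∀ j < n, Interlaces (c j) (c (j + 1))) (h0 : c 0 = 0)
    {i x : ℕ} (hx : x < c n i) :
    chainTableau hc h0 i x = #{y ∈ range n | c (y + 1) i ≤ x} :=
  if_pos hx

theorem chainTableau_lt (hc : ∀ j < n, Interlaces (c j) (c (j + 1))) (h0 : c 0 = 0) :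
    ∀ p ∈ chainShape hc h0, chainTableau hc h0 p.1 p.2 < n := by
  rintro ⟨i, x⟩ hp
  rw [mem_chainShape] at hp
  rw [chainTableau_apply hc h0 hp]
  exact (card_filter_lt_iff hc h0 le_rfl).2 hp

theorem tableauChain_chainTableau (hc : ∀ j < n, Interlaces (c j) (c (j + 1))) (h0 : c 0 = 0)
    (hcst : ∀ j, n ≤ j → c j = c n) : tableauChain (chainTableau hc h0) = c := by
  funext j i
  rcases le_total j n with hj | hj
  · refine eq_of_forall_lt_iff fun x => ?_
    rw [lt_tableauChain_iff, rowLen_chainShape]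
    refine ⟨fun h => ?_, fun h => ?_⟩
    · rw [chainTableau_apply hc h0 h.1, card_filter_lt_iff hc h0 hj] at h
      exact h.2
    · have hx := h.trans_le (chain_mono hc i hj le_rfl)
      rw [chainTableau_apply hc h0 hx, card_filter_lt_iff hc h0 hj]
      exact ⟨hx, h⟩
  · rw [tableauChain_eq_rowLen (chainTableau_lt hc h0) hj, rowLen_chainShape, hcst j hj]

end ofChain

/-- Tableaux of weight `ν` whose shape has `k` odd columns. -/
def oddColsTableaux (n d k : ℕ) (ν : Fin n → ℕ) :
    Set (Σ μ : YoungDiagram, SemistandardYoungTableau μ) :=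
  {T | (T.1.card = d ∧ oddColsCount T.1 = k) ∧
    ∀ j : ℕ, ssytWeight T.2 j = if h : j < n then ν ⟨j, h⟩ else 0}

theorem entry_lt_of_mem {n d k : ℕ} {ν : Fin n → ℕ}
    {T : Σ μ : YoungDiagram, SemistandardYoungTableau μ} (hT : T ∈ oddColsTableaux n d k ν) :
    ∀ c ∈ T.1, T.2 c.1 c.2 < n :=
  entry_lt_of_weight T.2 fun j hj => by rw [hT.2 j, dif_neg (by omega)]

theorem bijOn_tableauChain {n d k : ℕ} {ν : Fin n → ℕ} (hν : ∑ j, ν j = d) :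
    Set.BijOn (fun T : Σ μ : YoungDiagram, SemistandardYoungTableau μ => tableauChain T.2)
      (oddColsTableaux n d k ν) (chains n k ν) := by
  refine ⟨?_, ?_, ?_⟩
  · intro T hT
    have hlt := entry_lt_of_mem hT
    obtain ⟨⟨-, hk⟩, hw⟩ := hT
    refine ⟨?_, fun j _ => interlaces_tableauChain T.2 j, fun j hj => ?_, fun j => ?_, ?_⟩
    · funext i
      exact tableauChain_eq_zero T.2 i.zero_le
    · funext i
      simp only
      rw [tableauChain_eq_rowLen hlt hj, tableauChain_eq_rowLen hlt le_rfl]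
    · rw [sum_tableauChain_succ hlt, hw, dif_pos j.2]
    · simp only [tableauChain_eq_rowLen hlt le_rfl]
      rw [← oddColsCount_eq_alternatingSum T.1 fun i => rowLen_eq_zero hlt, hk]
  · intro S hS T hT h
    exact sigma_tableau_ext (entry_lt_of_mem hS) (entry_lt_of_mem hT) h
  · rintro c ⟨h0, hint, hcst, hwt, halt⟩
    have hlt := chainTableau_lt hint h0
    have hchain := tableauChain_chainTableau hint h0 hcst
    refine ⟨⟨chainShape hint h0, chainTableau hint h0⟩, ⟨⟨?_, ?_⟩, fun j => ?_⟩, hchain⟩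
    · have hsum : ∀ j (hj : j ≤ n), ∑ x ∈ range n, c j x = ∑ i : Fin j, ν (Fin.castLE hj i) := by
        intro j
        induction j with
        | zero => simp [h0]
        | succ j ih =>
          intro hj
          rw [hwt ⟨j, hj⟩, ih (by omega), Fin.sum_univ_castSucc]
          rfl
      rw [card_eq_sum_rowLen _ fun i => rowLen_eq_zero hlt]
      simp only [rowLen_chainShape]
      rw [hsum n le_rfl, ← hν]
      rfl
    · have := oddColsCount_eq_alternatingSum _ fun i => rowLen_eq_zero hlt (i := i)
      simp only [rowLen_chainShape] at this
      rw [halt] at this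
      exact_mod_cast this
    · split_ifs with hj
      · have h1 := sum_tableauChain_succ hlt j
        have h2 := hwt ⟨j, hj⟩
        rw [hchain] at h1
        simp only at h2 ⊢
        omega
      · exact weight_eq_zero _ hlt (by omega)

theorem ncard_eq_finsum_ncard_fiber {α : Type*} {β : α → Type*} {s : Set (Σ a, β a)}
    (hs : s.Finite) : s.ncard = ∑ᶠ a, {b : β a | (⟨a, b⟩ : Σ a, β a) ∈ s}.ncard := by
  classical
  have hfib : ∀ a, {b : β a | (⟨a, b⟩ : Σ a, β a) ∈ s}.ncard =
      #{x ∈ hs.toFinset | x.1 = a} := by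
    intro a
    rw [← Set.ncard_coe_finset, ← Set.ncard_image_of_injective _ (sigma_mk_injective (i := a))]
    congr 1
    ext ⟨a', b⟩
    simp only [Set.mem_image, Set.mem_ofPred_eq, coe_filter, Set.Finite.mem_toFinset]
    constructor
    · rintro ⟨b', hb', h⟩
      cases h
      exact ⟨hb', rfl⟩
    · rintro ⟨hb, rfl⟩
      exact ⟨b, hb, rfl⟩
  simp only [hfib]
  rw [Set.ncard_eq_toFinset_card s hs,
    card_eq_sum_card_image Sigma.fst, finsum_eq_sum_of_support_subset]
  intro a ha
  obtain ⟨x, hx⟩ := card_ne_zero.1 ha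
  rw [mem_filter] at hx
  exact mem_coe.2 (mem_image.2 ⟨x, hx⟩)

theorem finite_chains (n k : ℕ) (ν : Fin n → ℕ) : (chains n k ν).Finite := by
  rw [← (bijOn_growth n k ν).finite_iff_finite]
  refine (Set.finite_Iic (fun i _ => ν i : Fin n → Fin n → ℕ)).subset ?_
  rintro A ⟨-, hrow, -⟩ i j
  exact (single_le_sum (f := A i) (fun _ _ => Nat.zero_le _) (mem_univ j)).trans_eq (hrow i)

end GrowthDiagram

/-- **Schützenberger's lemma, enumerative form.** The number of symmetric `n × n` matrices of
nonnegative integers with row sums `ν` (summing to `d`) and trace `k` equals the number of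
semistandard Young tableaux of weight `ν` whose shape `λ ⊢ d` has exactly `k` odd columns. -/
theorem schuetzenberger_card (n d k : ℕ) (ν : Fin n → ℕ) (hν : ∑ j, ν j = d) :
    Set.ncard {A : Matrix (Fin n) (Fin n) ℕ |
        A.IsSymm ∧ (∀ i, ∑ j, A i j = ν i) ∧ ∑ i, A i i = k} =
      ∑ᶠ (lam : YoungDiagram) (_ : lam.card = d ∧ oddColsCount lam = k), tabCard lam ν := by
  have hbij := GrowthDiagram.bijOn_tableauChain (k := k) hν
  have hfin := hbij.finite_iff_finite.2 (GrowthDiagram.finite_chains n k ν)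
  rw [← (GrowthDiagram.bijOn_growth n k ν).injOn.ncard_image,
    (GrowthDiagram.bijOn_growth n k ν).image_eq, ← hbij.image_eq, hbij.injOn.ncard_image,
    GrowthDiagram.ncard_eq_finsum_ncard_fiber hfin]
  refine finsum_congr fun μ => ?_
  rw [finsum_eq_if]
  split_ifs with h
  · simp [GrowthDiagram.oddColsTableaux, tabCard, h]
  · simp [GrowthDiagram.oddColsTableaux, h]
end
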